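/- arXiv:1609.03260 — 9 statements merged into one kernel-verified Lean document; each statement's English description precedes it below -/
import Mathlib

section
/- Suppose (q1,s1) is feasible, q1+1 ≤ Q, and s1 minimizes H(q1,·) over all s such that (q1,s) is feasible. Then every minimizer s' of H(q1+1,·) over all s such that (q1+1,s) is feasible satisfies s1 ≤ s' ≤ s1+1. (This is the structural core of the paper's Theorem 2: in each policy-improvement step of policy iteration for the Lagrange-relaxed average-cost MDP, the minimizing action increases by at most 1 when the queue length increases by 1, i.e., the improved policy is threshold-based.) -/
/-- A queue/action pair `(q, s)` is feasible: the queue length is within the buffer,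
the action is within the transmitter limit, and no underflow/overflow occurs. -/
def Feasible (Q A S q s : ℤ) : Prop :=
  0 ≤ q ∧ q ≤ Q ∧ 0 ≤ s ∧ s ≤ S ∧ 0 ≤ q - s ∧ q - s ≤ Q - A

/-- The one-step policy-improvement cost
`H(q,s) = q + η P(s) + α (h(q-s+A) - h(A)) + (1-α)(h(q-s) - h(0))`. -/
noncomputable def Hcost (A : ℤ) (α η : ℝ) (P h : ℤ → ℝ) (q s : ℤ) : ℝ :=
  (q : ℝ) + η * P s + α * (h (q - s + A) - h A) + (1 - α) * (h (q - s) - h 0)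

/-- Strict convexity on `{0, …, S}` makes the forward differences strictly increasing there. -/
theorem forwardDiff_lt_of_strictConvex {S : ℤ} {P : ℤ → ℝ}
    (hP : ∀ s : ℤ, 0 ≤ s → s ≤ S - 2 → P (s + 1) - P s < P (s + 2) - P (s + 1))
    {a b : ℤ} (ha : 0 ≤ a) (hab : a + 1 ≤ b) (hb : b ≤ S - 1) :
    P (a + 1) - P a < P (b + 1) - P b := by
  induction b, hab using Int.leInduction with
  | base =>
    have h := hP a ha (by lia)
    rwa [show a + 1 + 1 = a + 2 by ring]
  | succ n hn ih =>
    have h := hP n (by lia) (by lia)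
    rw [show n + 1 + 1 = n + 2 by ring]
    exact (ih (by lia)).trans h

/-- The expected next-stage cost `x ↦ α h(x+A) + (1-α) h(x)` inherits strictly increasing
forward differences from `h`. -/
theorem mix_forwardDiff_lt {A : ℤ} {α : ℝ} {h : ℤ → ℝ} (hα0 : 0 ≤ α) (hα1 : α ≤ 1)
    (hh : StrictMono fun x : ℤ => h (x + 1) - h x) {x y : ℤ} (hxy : x < y) :
    α * (h (x + 1 + A) - h (x + A)) + (1 - α) * (h (x + 1) - h x) <
      α * (h (y + 1 + A) - h (y + A)) + (1 - α) * (h (y + 1) - h y) := by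
  have h0 : h (x + 1) - h x < h (y + 1) - h y := hh hxy
  have hA : h (x + A + 1) - h (x + A) < h (y + A + 1) - h (y + A) :=
    hh (add_lt_add_left hxy A)
  rw [add_right_comm x 1 A, add_right_comm y 1 A]
  rcases hα0.eq_or_lt with rfl | hpos
  · simpa using h0
  · exact add_lt_add_of_lt_of_le (mul_lt_mul_of_pos_left hA hpos)
      (mul_le_mul_of_nonneg_left h0.le (sub_nonneg.2 hα1))

theorem improved_action_increases_by_at_most_one
    (Q A S : ℤ) (hA1 : 1 ≤ A) (hAS : A ≤ S) (hAQ : A ≤ Q)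
    (α η : ℝ) (hα0 : 0 ≤ α) (hα1 : α ≤ 1) (hη : 0 < η)
    (P h : ℤ → ℝ)
    (hP : ∀ s : ℤ, 0 ≤ s → s ≤ S - 2 → P (s + 1) - P s < P (s + 2) - P (s + 1))
    (hh : StrictMono fun x : ℤ => h (x + 1) - h x)
    (q1 s1 : ℤ) (hfeas : Feasible Q A S q1 s1) (hq : q1 + 1 ≤ Q)
    (hmin : ∀ s : ℤ, Feasible Q A S q1 s → Hcost A α η P h q1 s1 ≤ Hcost A α η P h q1 s)
    (s' : ℤ) (hfeas' : Feasible Q A S (q1 + 1) s')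
    (hmin' : ∀ s : ℤ, Feasible Q A S (q1 + 1) s →
      Hcost A α η P h (q1 + 1) s' ≤ Hcost A α η P h (q1 + 1) s) :
    s1 ≤ s' ∧ s' ≤ s1 + 1 := by
  obtain ⟨hq0, _, hs0, hsS, hx0, hxQ⟩ := hfeas
  obtain ⟨_, _, ht0, htS, hy0, hyQ⟩ := hfeas'
  constructor
  · by_contra! hlt
    have h1 := hmin s' ⟨by lia, by lia, by lia, by lia, by lia, by lia⟩
    have h2 := hmin' s1 ⟨by lia, by lia, by lia, by lia, by lia, by lia⟩
    have h3 := mix_forwardDiff_lt (A := A) hα0 hα1 hh (show q1 - s1 < q1 - s' by lia)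
    simp only [Hcost, add_sub_right_comm q1 1] at h1 h2
    linarith
  · by_contra! hlt
    have h1 := hmin (s' - 1) ⟨by lia, by lia, by lia, by lia, by lia, by lia⟩
    have h2 := hmin' (s1 + 1) ⟨by lia, by lia, by lia, by lia, by lia, by lia⟩
    have h3 := forwardDiff_lt_of_strictConvex hP hs0 (show s1 + 1 ≤ s' - 1 by lia) (by lia)
    rw [sub_add_cancel] at h3
    have h4 := mul_lt_mul_of_pos_left h3 hη
    simp only [Hcost, show q1 - (s' - 1) = q1 + 1 - s' by ring, add_sub_add_right_eq_sub] at h1 h2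
    linarith
end

section
/- Suppose (q1,s1) is feasible, q1+1 ≤ Q, and H(q1,s1) ≤ H(q1,s1−δ) for every integer δ with 1 ≤ δ ≤ s1 for which (q1,s1−δ) is feasible. Then for every integer δ with 1 ≤ δ ≤ s1 such that both (q1+1,s1) and (q1+1,s1−δ) are feasible, the strict inequality H(q1+1,s1) < H(q1+1,s1−δ) holds. -/
theorem strict_improvement_over_smaller_actions
    (Q A S : ℤ) (hA1 : 1 ≤ A) (hAS : A ≤ S) (hAQ : A ≤ Q)
    (α η : ℝ) (hα0 : 0 ≤ α) (hα1 : α ≤ 1) (hη : 0 < η)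
    (P h : ℤ → ℝ)
    (hP : ∀ s : ℤ, 0 ≤ s → s ≤ S - 2 → P (s + 1) - P s < P (s + 2) - P (s + 1))
    (hh : StrictMono fun x : ℤ => h (x + 1) - h x)
    (q1 s1 : ℤ) (hfeas : Feasible Q A S q1 s1) (hq : q1 + 1 ≤ Q)
    (hmin : ∀ δ : ℤ, 1 ≤ δ → δ ≤ s1 → Feasible Q A S q1 (s1 - δ) →
      Hcost A α η P h q1 s1 ≤ Hcost A α η P h q1 (s1 - δ)) :
    ∀ δ : ℤ, 1 ≤ δ → δ ≤ s1 → Feasible Q A S (q1 + 1) s1 →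
      Feasible Q A S (q1 + 1) (s1 - δ) →
      Hcost A α η P h (q1 + 1) s1 < Hcost A α η P h (q1 + 1) (s1 - δ) := by
  intro δ hδ hδs _ hfeas'
  have hle := hmin δ hδ hδs (by unfold Feasible at *; omega)
  have h₁ := hh (show q1 - s1 + A < q1 - (s1 - δ) + A by omega)
  have h₀ := hh (show q1 - s1 < q1 - (s1 - δ) by omega)
  have hpos : 0 < α * ((h (q1 - (s1 - δ) + A + 1) - h (q1 - (s1 - δ) + A))
        - (h (q1 - s1 + A + 1) - h (q1 - s1 + A)))
      + (1 - α) * ((h (q1 - (s1 - δ) + 1) - h (q1 - (s1 - δ)))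
        - (h (q1 - s1 + 1) - h (q1 - s1))) := by
    rcases hα0.eq_or_lt with rfl | hα
    · linarith
    · exact add_pos_of_pos_of_nonneg (mul_pos hα (sub_pos.2 h₁))
        (mul_nonneg (sub_nonneg.2 hα1) (sub_nonneg.2 h₀.le))
  have shift (t : ℤ) : q1 + 1 - t = q1 - t + 1 := by ring
  have shiftA (t : ℤ) : q1 + 1 - t + A = q1 - t + A + 1 := by ring
  unfold Hcost at *
  rw [shiftA, shiftA, shift, shift]
  linarith
end

section
/- Suppose (q1,s1) is feasible, q1+1 ≤ Q, and H(q1,s1) ≤ H(q1,s1+δ) for every integer δ ≥ 1 for which (q1,s1+δ) is feasible. Then for every integer δ ≥ 1 such that (q1+1,s1+1+δ) is feasible, the strict inequality H(q1+1,s1+1) < H(q1+1,s1+1+δ) holds (note that (q1+1,s1+1) is automatically feasible in this situation). -/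
/-- Forward differences of a function that is strictly convex on `{0, ..., S}` are strictly
increasing there. -/
theorem forwardDiff_lt_of_strictConvex_s2 {S : ℤ} {P : ℤ → ℝ}
    (hP : ∀ s : ℤ, 0 ≤ s → s ≤ S - 2 → P (s + 1) - P s < P (s + 2) - P (s + 1))
    {s : ℤ} (hs : 0 ≤ s) {δ : ℤ} (hδ : 1 ≤ δ) :
    s + δ + 1 ≤ S → P (s + 1) - P s < P (s + δ + 1) - P (s + δ) := by
  induction δ, hδ using Int.leInduction with
  | base =>
    intro h
    have := hP s hs (by omega)
    rwa [show s + 1 + 1 = s + 2 by ring]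
  | succ n hn ih =>
    intro h
    have hstep := hP (s + n) (by omega) (by omega)
    rw [show s + (n + 1) + 1 = s + n + 2 by ring, show s + (n + 1) = s + n + 1 by ring]
    exact (ih (by omega)).trans hstep

theorem strict_improvement_over_larger_actions
    (Q A S : ℤ) (hA1 : 1 ≤ A) (hAS : A ≤ S) (hAQ : A ≤ Q)
    (α η : ℝ) (hα0 : 0 ≤ α) (hα1 : α ≤ 1) (hη : 0 < η)
    (P h : ℤ → ℝ)
    (hP : ∀ s : ℤ, 0 ≤ s → s ≤ S - 2 → P (s + 1) - P s < P (s + 2) - P (s + 1))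
    (hh : StrictMono fun x : ℤ => h (x + 1) - h x)
    (q1 s1 : ℤ) (hfeas : Feasible Q A S q1 s1) (hq : q1 + 1 ≤ Q)
    (hmin : ∀ δ : ℤ, 1 ≤ δ → Feasible Q A S q1 (s1 + δ) →
      Hcost A α η P h q1 s1 ≤ Hcost A α η P h q1 (s1 + δ)) :
    ∀ δ : ℤ, 1 ≤ δ → Feasible Q A S (q1 + 1) (s1 + 1 + δ) →
      Feasible Q A S (q1 + 1) (s1 + 1) ∧
      Hcost A α η P h (q1 + 1) (s1 + 1) < Hcost A α η P h (q1 + 1) (s1 + 1 + δ) := by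
  intro δ hδ hf
  unfold Feasible at *
  refine ⟨by omega, ?_⟩
  have hle := hmin δ hδ (by omega)
  have hlt := mul_lt_mul_of_pos_left
    (forwardDiff_lt_of_strictConvex_s2 hP (s := s1) (by omega) hδ (by omega)) hη
  unfold Hcost at *
  rw [show q1 + 1 - (s1 + 1) = q1 - s1 by ring,
    show q1 + 1 - (s1 + 1 + δ) = q1 - (s1 + δ) by ring,
    show s1 + 1 + δ = s1 + δ + 1 by ring]
  linarith
end

section
/- Suppose (q1,s1) is feasible with 1 ≤ s1, s1+1 ≤ S and q1+1 ≤ Q; suppose s1 is the least minimizer of H(q1,·) over feasible actions at q1 (i.e., H(q1,s1) ≤ H(q1,s) for all s with (q1,s) feasible, with strict inequality whenever s < s1); and suppose s2 ∈ {s1, s1+1} is such that (q1+1,s2) is feasible and s2 minimizes H(q1+1,·) over feasible actions at q1+1. Then 1 + η·(P(s1) − P(s1−1)) < H(q1+1,s2) − H(q1,s1) ≤ 1 + η·(P(s1+1) − P(s1)). -/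
theorem value_increment_bounds
    (Q A S : ℤ) (hA1 : 1 ≤ A) (hAS : A ≤ S) (hAQ : A ≤ Q)
    (α η : ℝ) (hα0 : 0 ≤ α) (hα1 : α ≤ 1) (hη : 0 < η)
    (P h : ℤ → ℝ)
    (hP : ∀ s : ℤ, 0 ≤ s → s ≤ S - 2 → P (s + 1) - P s < P (s + 2) - P (s + 1))
    (hh : StrictMono fun x : ℤ => h (x + 1) - h x)
    (q1 s1 : ℤ) (hfeas : Feasible Q A S q1 s1)
    (hs1 : 1 ≤ s1) (hs1S : s1 + 1 ≤ S) (hq : q1 + 1 ≤ Q)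
    (hmin : ∀ s : ℤ, Feasible Q A S q1 s → Hcost A α η P h q1 s1 ≤ Hcost A α η P h q1 s)
    (hleast : ∀ s : ℤ, Feasible Q A S q1 s → s < s1 →
      Hcost A α η P h q1 s1 < Hcost A α η P h q1 s)
    (s2 : ℤ) (hs2 : s2 = s1 ∨ s2 = s1 + 1) (hfeas2 : Feasible Q A S (q1 + 1) s2)
    (hmin2 : ∀ s : ℤ, Feasible Q A S (q1 + 1) s →
      Hcost A α η P h (q1 + 1) s2 ≤ Hcost A α η P h (q1 + 1) s) :
    1 + η * (P s1 - P (s1 - 1)) < Hcost A α η P h (q1 + 1) s2 - Hcost A α η P h q1 s1 ∧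
    Hcost A α η P h (q1 + 1) s2 - Hcost A α η P h q1 s1 ≤ 1 + η * (P (s1 + 1) - P s1) := by
  obtain ⟨hq0, hqQ, hs0, hsS, hd0, hdQ⟩ := hfeas
  have served : ∀ q s : ℤ, Hcost A α η P h (q + 1) (s + 1) =
      Hcost A α η P h q s + 1 + η * (P (s + 1) - P s) := by
    intro q s
    simp only [Hcost, add_sub_add_right_eq_sub]
    push_cast
    ring
  constructor
  · rcases hs2 with rfl | rfl
    · obtain ⟨_, _, _, _, _, hd2⟩ := hfeas2
      have hlt := hleast (s2 - 1) (by unfold Feasible; omega) (by omega)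
      have heq := served q1 (s2 - 1)
      rw [sub_add_cancel] at heq
      linarith
    · have hconv := hP (s1 - 1) (by omega) (by omega)
      rw [sub_add_cancel, show s1 - 1 + 2 = s1 + 1 by ring] at hconv
      linarith [served q1 s1, mul_lt_mul_of_pos_left hconv hη]
  · have hle := hmin2 (s1 + 1) (by unfold Feasible; omega)
    linarith [served q1 s1]
end

section
/- Let s : {0,...,Q} → {0,...,S} be a selection such that for each q, (q,s(q)) is feasible, s(q) is the least minimizer of H(q,·) over feasible actions at q, and s(q+1) − s(q) ∈ {0,1} for all 0 ≤ q ≤ Q−1. Then the induced value function q ↦ H(q,s(q)) is convex on {0,...,Q}: for every q with 0 ≤ q ≤ Q−2, H(q+2,s(q+2)) − H(q+1,s(q+1)) ≥ H(q+1,s(q+1)) − H(q,s(q)). -/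
/-- Moving one unit of action between queue lengths `q`, `q + 2` and two copies of `q + 1`
preserves the total cost. -/
lemma Hcost_add_Hcost_exchange (A : ℤ) (α η : ℝ) (P h : ℤ → ℝ) (q a : ℤ) :
    Hcost A α η P h q a + Hcost A α η P h (q + 2) (a + 1) =
      Hcost A α η P h (q + 1) a + Hcost A α η P h (q + 1) (a + 1) := by
  unfold Hcost
  rw [show q + 2 - (a + 1) = q + 1 - a by ring, show q + 1 - (a + 1) = q - a by ring]
  push_cast
  ring

/-- For a fixed action the cost is convex in the queue length. -/
lemma Hcost_sub_le_of_const (A : ℤ) {α η : ℝ} (hα0 : 0 ≤ α) (hα1 : α ≤ 1) (P : ℤ → ℝ)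
    {h : ℤ → ℝ} (hh : StrictMono fun x : ℤ => h (x + 1) - h x) (q a : ℤ) :
    Hcost A α η P h (q + 1) a - Hcost A α η P h q a ≤
      Hcost A α η P h (q + 2) a - Hcost A α η P h (q + 1) a := by
  have key (x : ℤ) : h (x + 1) - h x ≤ h (x + 2) - h (x + 1) := by
    have hx := (hh (lt_add_one x)).le
    simpa only [add_assoc, one_add_one_eq_two] using hx
  have h₁ := mul_le_mul_of_nonneg_left (key (q - a + A)) hα0
  have h₂ := mul_le_mul_of_nonneg_left (key (q - a)) (sub_nonneg.2 hα1)
  unfold Hcost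
  rw [show q + 1 - a = q - a + 1 by ring, show q + 2 - a = q - a + 2 by ring,
    show q - a + 1 + A = q - a + A + 1 by ring, show q - a + 2 + A = q - a + A + 2 by ring]
  push_cast
  linarith

/-- If the action grows with the queue length, the cost inherits the convexity of `P`. -/
lemma Hcost_sub_le_of_diagonal (A : ℤ) (α : ℝ) {η : ℝ} {P : ℤ → ℝ} (h : ℤ → ℝ) (hη : 0 ≤ η)
    (q : ℤ) {a : ℤ} (hP : P (a + 1) - P a ≤ P (a + 2) - P (a + 1)) :
    Hcost A α η P h (q + 1) (a + 1) - Hcost A α η P h q a ≤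
      Hcost A α η P h (q + 2) (a + 2) - Hcost A α η P h (q + 1) (a + 1) := by
  have h₁ := mul_le_mul_of_nonneg_left hP hη
  unfold Hcost
  simp only [add_sub_add_right_eq_sub]
  push_cast
  linarith

theorem value_function_convex_of_threshold_selection
    (Q A S : ℤ) (hA1 : 1 ≤ A) (hAS : A ≤ S) (hAQ : A ≤ Q)
    (α η : ℝ) (hα0 : 0 ≤ α) (hα1 : α ≤ 1) (hη : 0 < η)
    (P h : ℤ → ℝ)
    (hP : ∀ s : ℤ, 0 ≤ s → s ≤ S - 2 → P (s + 1) - P s < P (s + 2) - P (s + 1))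
    (hh : StrictMono fun x : ℤ => h (x + 1) - h x)
    (s : ℤ → ℤ)
    (hfeas : ∀ q : ℤ, 0 ≤ q → q ≤ Q → Feasible Q A S q (s q))
    (hmin : ∀ q : ℤ, 0 ≤ q → q ≤ Q → ∀ s' : ℤ, Feasible Q A S q s' →
      Hcost A α η P h q (s q) ≤ Hcost A α η P h q s')
    (hleast : ∀ q : ℤ, 0 ≤ q → q ≤ Q → ∀ s' : ℤ, Feasible Q A S q s' → s' < s q →
      Hcost A α η P h q (s q) < Hcost A α η P h q s')
    (hstep : ∀ q : ℤ, 0 ≤ q → q ≤ Q - 1 → s (q + 1) - s q = 0 ∨ s (q + 1) - s q = 1) :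
    ∀ q : ℤ, 0 ≤ q → q ≤ Q - 2 →
      Hcost A α η P h (q + 1) (s (q + 1)) - Hcost A α η P h q (s q) ≤
      Hcost A α η P h (q + 2) (s (q + 2)) - Hcost A α η P h (q + 1) (s (q + 1)) := by
  intro q hq0 hq2
  obtain ⟨-, -, ha0, haS, hx0, hxQ⟩ := hfeas q hq0 (by omega)
  obtain ⟨-, -, hc0, hcS, hy0, hyQ⟩ := hfeas (q + 2) (by omega) (by omega)
  have hab := hstep q hq0 (by omega)
  have hbc := hstep (q + 1) (by omega) (by omega)
  rw [add_assoc, one_add_one_eq_two] at hbc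
  have hq1 := hmin (q + 1) (by omega) (by omega)
  by_cases hca : s (q + 2) = s q + 1
  · -- Serving `s q` and serving `s q + 1` are both feasible at `q + 1`.
    have h₁ := hq1 (s q) ⟨by omega, by omega, ha0, haS, by omega, by omega⟩
    have h₂ := hq1 (s q + 1) ⟨by omega, by omega, by omega, by omega, by omega, by omega⟩
    have hsum := Hcost_add_Hcost_exchange A α η P h q (s q)
    rw [hca]
    linarith
  · rcases hab with hab | hab <;> rcases hbc with hbc | hbc
    · rw [show s (q + 2) = s q by omega, show s (q + 1) = s q by omega]
      exact Hcost_sub_le_of_const A hα0 hα1 P hh q (s q)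
    · omega
    · omega
    · rw [show s (q + 2) = s q + 2 by omega, show s (q + 1) = s q + 1 by omega]
      exact Hcost_sub_le_of_diagonal A α h hη.le q (hP (s q) ha0 (by omega)).le
end

section
/- Let ε ∈ ℝ satisfy 1 + ε·h ≠ 0 and also 1 + h ≠ 0 (so both H + ε·ΔH and H + ΔH are invertible). Then for all column vectors c, d ∈ ℝⁿ: dᵀ·(H + ε·ΔH)⁻¹·c − dᵀ·H⁻¹·c = (ε·(1+h)/(1+ε·h)) · ( dᵀ·(H + ΔH)⁻¹·c − dᵀ·H⁻¹·c ). (This is the key identity behind the paper's Lemma 1: the average delay of a convex combination of two scheduling policies differing in one state is a convex combination of the two average delays, with coefficient ε' = ε(1+h)/(1+εh).) -/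
open Matrix

/-- The Sherman–Morrison formula. -/
theorem inv_add_vecMulVec {ι K : Type*} [Fintype ι] [DecidableEq ι] [Field K]
    {A : Matrix ι ι K} (hA : IsUnit A.det) (u v : ι → K) (h : 1 + v ⬝ᵥ (A⁻¹ *ᵥ u) ≠ 0) :
    (A + vecMulVec u v)⁻¹ =
      A⁻¹ - (1 + v ⬝ᵥ (A⁻¹ *ᵥ u))⁻¹ • vecMulVec (A⁻¹ *ᵥ u) (v ᵥ* A⁻¹) := by
  apply inv_eq_right_inv
  have hAu : A *ᵥ (A⁻¹ *ᵥ u) = u := by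
    rw [mulVec_mulVec, mul_nonsing_inv A hA, one_mulVec]
  rw [add_mul, mul_sub, mul_sub, mul_nonsing_inv A hA, mul_smul_comm, mul_smul_comm,
    mul_vecMulVec, hAu, vecMulVec_mul, vecMulVec_mul_vecMulVec, vecMulVec_smul]
  generalize v ⬝ᵥ (A⁻¹ *ᵥ u) = s at h ⊢
  ext i j
  simp only [Matrix.add_apply, Matrix.sub_apply, Matrix.smul_apply, smul_eq_mul]
  field_simp
  ring

theorem delay_convex_combination_identity
    (n : ℕ) (hn : 1 ≤ n) (H : Matrix (Fin n) (Fin n) ℝ) (hH : IsUnit H.det)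
    (δ : Fin n → ℝ) (q : Fin n) (ε : ℝ)
    (hε : 1 + ε * (H⁻¹ *ᵥ δ) q ≠ 0) (h1 : 1 + (H⁻¹ *ᵥ δ) q ≠ 0)
    (c d : Fin n → ℝ) :
    d ⬝ᵥ ((H + ε • Matrix.vecMulVec δ (Pi.single q 1))⁻¹ *ᵥ c) - d ⬝ᵥ (H⁻¹ *ᵥ c) =
      ε * (1 + (H⁻¹ *ᵥ δ) q) / (1 + ε * (H⁻¹ *ᵥ δ) q) *
        (d ⬝ᵥ ((H + Matrix.vecMulVec δ (Pi.single q 1))⁻¹ *ᵥ c) - d ⬝ᵥ (H⁻¹ *ᵥ c)) := by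
  rw [← smul_vecMulVec,
    inv_add_vecMulVec hH (ε • δ) _ (by simpa [mulVec_smul] using hε),
    inv_add_vecMulVec hH δ _ (by simpa using h1)]
  simp only [mulVec_smul, smul_vecMulVec, single_one_dotProduct, smul_eq_mul,
    sub_mulVec, smul_mulVec, dotProduct_sub, dotProduct_smul]
  field_simp
  ring
end

section
/- Suppose 1 + h ≠ 0, let ζ ∈ ℝ, let p, c, d ∈ ℝⁿ be column vectors, and set Δp = ζ·e_q. Then ( dᵀ·(H + ΔH)⁻¹·c − dᵀ·H⁻¹·c ) · ( pᵀ·H⁻¹·δ − ζ ) = ( (p + Δp)ᵀ·(H + ΔH)⁻¹·c − pᵀ·H⁻¹·c ) · ( dᵀ·H⁻¹·δ ). (In the paper this gives the slope formula for the line segment in the delay-power plane joining the points of two policies that differ in one state: (D_{F'} − D_F)/(P_{F'} − P_F) = dᵀH⁻¹δ_q / (αA·(pᵀH⁻¹δ_q − ζ_q)).) -/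
open Matrix

section ColumnUpdate

variable {n K : Type*} [Fintype n] [DecidableEq n] [Field K]

theorem inv_mulVec_add_vecMulVec_single_mulVec {H : Matrix n n K} (hH : IsUnit H.det)
    (δ : n → K) (q : n) (v : n → K) :
    H⁻¹ *ᵥ ((H + vecMulVec δ (Pi.single q 1)) *ᵥ v) = v + v q • (H⁻¹ *ᵥ δ) := by
  have hδ : vecMulVec δ (Pi.single q 1) *ᵥ v = v q • δ := by
    simp [vecMulVec_mulVec]
  rw [add_mulVec, hδ, mulVec_add, mulVec_smul, mulVec_mulVec, nonsing_inv_mul _ hH, one_mulVec]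

theorem isUnit_add_vecMulVec_single {H : Matrix n n K} (hH : IsUnit H.det)
    {δ : n → K} {q : n} (h : 1 + (H⁻¹ *ᵥ δ) q ≠ 0) :
    IsUnit (H + vecMulVec δ (Pi.single q 1)) := by
  rw [← mulVec_injective_iff_isUnit, ← coe_mulVecLin, ← LinearMap.ker_eq_bot,
    LinearMap.ker_eq_bot']
  intro v hv
  have hsum := inv_mulVec_add_vecMulVec_single_mulVec hH δ q v
  rw [mulVecLin_apply] at hv
  rw [hv, mulVec_zero] at hsum
  have hq : v q * (1 + (H⁻¹ *ᵥ δ) q) = 0 := by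
    have := congrFun hsum q
    simp only [Pi.zero_apply, Pi.add_apply, Pi.smul_apply, smul_eq_mul] at this
    rw [this]
    ring
  rw [(mul_eq_zero.mp hq).resolve_right h, zero_smul, add_zero] at hsum
  exact hsum.symm

theorem inv_mulVec_eq_add_smul {H : Matrix n n K} (hH : IsUnit H.det)
    {δ : n → K} {q : n} (h : 1 + (H⁻¹ *ᵥ δ) q ≠ 0) (c : n → K) :
    H⁻¹ *ᵥ c = (H + vecMulVec δ (Pi.single q 1))⁻¹ *ᵥ c +
      ((H + vecMulVec δ (Pi.single q 1))⁻¹ *ᵥ c) q • (H⁻¹ *ᵥ δ) := by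
  rw [← inv_mulVec_add_vecMulVec_single_mulVec hH, mulVec_mulVec c,
    mul_nonsing_inv _ ((isUnit_iff_isUnit_det _).mp (isUnit_add_vecMulVec_single hH h)),
    one_mulVec]

end ColumnUpdate

theorem slope_identity
    (n : ℕ) (hn : 1 ≤ n) (H : Matrix (Fin n) (Fin n) ℝ) (hH : IsUnit H.det)
    (δ : Fin n → ℝ) (q : Fin n)
    (h1 : 1 + (H⁻¹ *ᵥ δ) q ≠ 0)
    (ζ : ℝ) (p c d : Fin n → ℝ) :
    (d ⬝ᵥ ((H + Matrix.vecMulVec δ (Pi.single q 1))⁻¹ *ᵥ c) - d ⬝ᵥ (H⁻¹ *ᵥ c)) *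
        (p ⬝ᵥ (H⁻¹ *ᵥ δ) - ζ) =
      ((p + ζ • (Pi.single q 1 : Fin n → ℝ)) ⬝ᵥ
          ((H + Matrix.vecMulVec δ (Pi.single q 1))⁻¹ *ᵥ c) - p ⬝ᵥ (H⁻¹ *ᵥ c)) *
        (d ⬝ᵥ (H⁻¹ *ᵥ δ)) := by
  rw [inv_mulVec_eq_add_smul hH h1 c]
  simp only [dotProduct_add, add_dotProduct, dotProduct_smul, smul_dotProduct,
    single_one_dotProduct, smul_eq_mul]
  ring
end

section
/- Let F be an m×k real matrix with entries in [0,1] whose every row sums to 1, and fix indices (q*, s*) with 0 < F(q*,s*) < 1. Define F' to be equal to F except in row q*, where F'(q*,s*) = 1 and F'(q*,s) = 0 for s ≠ s*; define F'' to be equal to F except in row q*, where F''(q*,s*) = 0 and F''(q*,s) = F(q*,s)/(1 − F(q*,s*)) for s ≠ s*. Then: (i) F' and F'' have entries in [0,1] and all rows summing to 1; (ii) F = F(q*,s*)·F' + (1 − F(q*,s*))·F''; (iii) whenever F(q,s) = 0, also F'(q,s) = 0 and F''(q,s) = 0; and (iv) F' and F'' differ from each other only in row q*, and each has strictly fewer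 entries lying strictly between 0 and 1 than F does. -/
theorem Finset.card_filter_lt_card_filter {α : Type*} [Fintype α] {P Q : α → Prop}
    [DecidablePred P] [DecidablePred Q] (hPQ : ∀ a, P a → Q a) (a : α) (hQ : Q a) (hP : ¬ P a) :
    (Finset.univ.filter P).card < (Finset.univ.filter Q).card := by
  refine Finset.card_lt_card ((Finset.ssubset_iff_of_subset
    (Finset.monotone_filter_right _ fun b _ => hPQ b)).2 ⟨a, ?_, ?_⟩)
  · simpa using hQ
  · simpa using hP

theorem policy_decomposition
    (m k : ℕ) (F : Fin m → Fin k → ℝ)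
    (hF01 : ∀ q s, 0 ≤ F q s ∧ F q s ≤ 1)
    (hFrow : ∀ q, ∑ s, F q s = 1)
    (qstar : Fin m) (sstar : Fin k)
    (hfrac : 0 < F qstar sstar ∧ F qstar sstar < 1)
    (F' F'' : Fin m → Fin k → ℝ)
    (hF' : ∀ q s, F' q s =
      if q = qstar then (if s = sstar then 1 else 0) else F q s)
    (hF'' : ∀ q s, F'' q s =
      if q = qstar then (if s = sstar then 0 else F q s / (1 - F qstar sstar))
      else F q s) :
    -- (i) F' and F'' are row-stochastic with entries in [0,1]
    ((∀ q s, 0 ≤ F' q s ∧ F' q s ≤ 1) ∧ (∀ q, ∑ s, F' q s = 1) ∧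
     (∀ q s, 0 ≤ F'' q s ∧ F'' q s ≤ 1) ∧ (∀ q, ∑ s, F'' q s = 1)) ∧
    -- (ii) F is the convex combination of F' and F''
    (∀ q s, F q s = F qstar sstar * F' q s + (1 - F qstar sstar) * F'' q s) ∧
    -- (iii) the support only shrinks
    (∀ q s, F q s = 0 → F' q s = 0 ∧ F'' q s = 0) ∧
    -- (iv) F' and F'' differ only in row qstar, and each has strictly fewer
    -- entries strictly between 0 and 1 than F
    ((∀ q, q ≠ qstar → ∀ s, F' q s = F'' q s) ∧
     (Finset.univ.filter fun p : Fin m × Fin k =>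
        0 < F' p.1 p.2 ∧ F' p.1 p.2 < 1).card <
       (Finset.univ.filter fun p : Fin m × Fin k =>
        0 < F p.1 p.2 ∧ F p.1 p.2 < 1).card ∧
     (Finset.univ.filter fun p : Fin m × Fin k =>
        0 < F'' p.1 p.2 ∧ F'' p.1 p.2 < 1).card <
       (Finset.univ.filter fun p : Fin m × Fin k =>
        0 < F p.1 p.2 ∧ F p.1 p.2 < 1).card) := by
  obtain ⟨hpos, hlt⟩ := hfrac
  have hden : 0 < 1 - F qstar sstar := sub_pos.2 hlt
  have hsum : F qstar sstar + ∑ s ∈ Finset.univ.erase sstar, F qstar s = 1 := by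
    rw [Finset.add_sum_erase _ _ (Finset.mem_univ sstar), hFrow]
  have hle : ∀ s, s ≠ sstar → F qstar s ≤ 1 - F qstar sstar := fun s hs => by
    have := Finset.single_le_sum (f := F qstar) (fun i _ => (hF01 qstar i).1)
      (Finset.mem_erase.2 ⟨hs, Finset.mem_univ s⟩)
    linarith
  refine ⟨⟨fun q s => ?_, fun q => ?_, fun q s => ?_, fun q => ?_⟩, fun q s => ?_,
    fun q s h => ?_, fun q hq s => ?_, ?_, ?_⟩
  · rw [hF']
    split_ifs
    exacts [⟨zero_le_one, le_rfl⟩, ⟨le_rfl, zero_le_one⟩, hF01 q s]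
  · by_cases hq : q = qstar <;> simp [hF', hq, hFrow]
  · rw [hF'']
    split_ifs with hq hs
    · exact ⟨le_rfl, zero_le_one⟩
    · subst hq
      exact ⟨div_nonneg (hF01 q s).1 hden.le, (div_le_one hden).2 (hle s hs)⟩
    · exact hF01 q s
  · by_cases hq : q = qstar
    · subst hq
      rw [← Finset.add_sum_erase _ _ (Finset.mem_univ sstar),
        Finset.sum_congr rfl fun s hs => by
          rw [hF'', if_pos rfl, if_neg (Finset.ne_of_mem_erase hs)],
        ← Finset.sum_div, hF'', if_pos rfl, if_pos rfl, zero_add, div_eq_one_iff_eq hden.ne']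
      linarith
    · simp [hF'', hq, hFrow]
  · rw [hF', hF'']
    split_ifs with hq hs
    · rw [hq, hs]
      ring
    · subst hq
      field_simp
      ring
    · ring
  · rw [hF', hF'']
    split_ifs with hq hs
    · subst hq hs
      exact absurd h hpos.ne'
    · simp [h]
    · exact ⟨h, h⟩
  · rw [hF', hF'', if_neg hq, if_neg hq]
  · refine Finset.card_filter_lt_card_filter (fun p hp => ?_) (qstar, sstar) ⟨hpos, hlt⟩ ?_
    · rw [hF'] at hp
      split_ifs at hp
      · exact absurd hp.2 (lt_irrefl _)
      · exact absurd hp.1 (lt_irrefl _)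
      · exact hp
    · simp [hF']
  · refine Finset.card_filter_lt_card_filter (fun p hp => ?_) (qstar, sstar) ⟨hpos, hlt⟩ ?_
    · rw [hF''] at hp
      split_ifs at hp with hq hs
      · exact absurd hp.1 (lt_irrefl _)
      · rw [hq] at hp ⊢
        rw [div_pos_iff_of_pos_right hden, div_lt_one hden] at hp
        exact ⟨hp.1, by linarith [hp.2]⟩
      · exact hp
    · simp [hF'']
end

section
/- Let Q ≥ 1 and S ≥ 1 be integers. Let t : {0,...,S} → {0,...,Q} be nondecreasing with t(S) = Q, and set t(−1) = −1; let F_t be the associated deterministic threshold policy matrix. Fix s* with 0 ≤ s* < S and t(s*−1) < t(s*), and let t' equal t except that t'(s*) = t(s*) − 1. Then t' is nondecreasing with t'(S) = Q, and for every ε ∈ [0,1] the matrix F'' = (1−ε)·F_t + ε·F_{t'} agrees with F_t in every row q ≠ t(s*), while its row q = t(s*) has entry 1−ε in column s*, entry ε in column s*+1, and 0 in all other columns; in particular every row of F'' sums to 1 and F'' is threshold-based with thresholds t (i.e., F''(q,s) > 0 only when t(s−1) ≤ q ≤ t(s)). -/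
/-- The deterministic threshold policy associated with thresholds `t`:
transmit `s` packets in state `q` iff `t (s-1) < q ≤ t s`. -/
def thresholdPolicy (t : ℤ → ℤ) (q s : ℤ) : ℝ :=
  if t (s - 1) < q ∧ q ≤ t s then 1 else 0

theorem le_of_le_add_one_of_mem_Icc {t : ℤ → ℤ} {a S : ℤ}
    (ht : ∀ s : ℤ, a ≤ s → s ≤ S - 1 → t s ≤ t (s + 1)) {i j : ℤ}
    (hi : a ≤ i) (hij : i ≤ j) (hj : j ≤ S) : t i ≤ t j := by
  induction j, hij using Int.leInduction with
  | base => exact le_rfl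
  | succ n hn ih => exact (ih (by lia)).trans (ht n (by lia) (by lia))

theorem sum_Icc_thresholdPolicy {t : ℤ → ℤ} {S q : ℤ}
    (ht : ∀ s : ℤ, -1 ≤ s → s ≤ S - 1 → t s ≤ t (s + 1)) (hq : t (-1) < q)
    {n : ℤ} (hn : -1 ≤ n) (hnS : n ≤ S) :
    ∑ s ∈ Finset.Icc (0 : ℤ) n, thresholdPolicy t q s = if q ≤ t n then 1 else 0 := by
  induction n, hn using Int.leInduction with
  | base => simp [hq]
  | succ n hn ih =>
    have hins : Finset.Icc (0 : ℤ) (n + 1) = insert (n + 1) (Finset.Icc 0 n) := by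
      ext x
      simp only [Finset.mem_Icc, Finset.mem_insert]
      lia
    have hstep := ht n hn (by lia)
    rw [hins, Finset.sum_insert (by simp), ih (by lia), thresholdPolicy, add_sub_cancel_right]
    split_ifs <;> first | lia | norm_num

theorem mixture_of_adjacent_threshold_policies
    (Q S : ℤ) (hQ : 1 ≤ Q) (hS : 1 ≤ S)
    (t : ℤ → ℤ)
    (ht_neg : t (-1) = -1)
    (ht_range : ∀ s : ℤ, 0 ≤ s → s ≤ S → 0 ≤ t s ∧ t s ≤ Q)
    (ht_mono : ∀ s : ℤ, -1 ≤ s → s ≤ S - 1 → t s ≤ t (s + 1))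
    (ht_top : t S = Q)
    (sstar : ℤ) (hs0 : 0 ≤ sstar) (hsS : sstar < S) (hsgap : t (sstar - 1) < t sstar)
    (t' : ℤ → ℤ) (ht' : ∀ s : ℤ, t' s = if s = sstar then t sstar - 1 else t s)
    (ε : ℝ) (hε0 : 0 ≤ ε) (hε1 : ε ≤ 1)
    (F'' : ℤ → ℤ → ℝ)
    (hF'' : ∀ q s : ℤ, F'' q s = (1 - ε) * thresholdPolicy t q s + ε * thresholdPolicy t' q s) :
    -- t' is a valid system of thresholds
    ((∀ s : ℤ, -1 ≤ s → s ≤ S - 1 → t' s ≤ t' (s + 1)) ∧ t' S = Q) ∧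
    -- F'' agrees with F_t in every row other than q = t sstar
    (∀ q s : ℤ, q ≠ t sstar → F'' q s = thresholdPolicy t q s) ∧
    -- the row q = t sstar randomizes between sstar and sstar + 1
    (F'' (t sstar) sstar = 1 - ε ∧ F'' (t sstar) (sstar + 1) = ε ∧
      ∀ s : ℤ, 0 ≤ s → s ≤ S → s ≠ sstar → s ≠ sstar + 1 → F'' (t sstar) s = 0) ∧
    -- every row (within the buffer range) sums to 1
    (∀ q : ℤ, 0 ≤ q → q ≤ Q → ∑ s ∈ Finset.Icc (0 : ℤ) S, F'' q s = 1) ∧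
    -- F'' is threshold-based with thresholds t
    (∀ q s : ℤ, 0 ≤ q → q ≤ Q → 0 ≤ s → s ≤ S → 0 < F'' q s →
      t (s - 1) ≤ q ∧ q ≤ t s) := by
  have mono : ∀ i j : ℤ, -1 ≤ i → i ≤ j → j ≤ S → t i ≤ t j :=
    fun i j hi hij hj => le_of_le_add_one_of_mem_Icc ht_mono hi hij hj
  have hself : t' sstar = t sstar - 1 := by simp [ht']
  have hother : ∀ s, s ≠ sstar → t' s = t s := fun s hs => by simp [ht', hs]
  have ht'_mono : ∀ s : ℤ, -1 ≤ s → s ≤ S - 1 → t' s ≤ t' (s + 1) := by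
    intro s h1 h2
    have hstep := ht_mono s h1 h2
    by_cases hs : s = sstar
    · subst hs
      rw [hself, hother _ (by lia)]
      lia
    · by_cases hs' : s + 1 = sstar
      · obtain rfl : s = sstar - 1 := by lia
        rw [hs', hself, hother _ hs]
        lia
      · rwa [hother _ hs, hother _ hs']
  have ht'_top : t' S = Q := by rw [hother S (by lia), ht_top]
  have hnext : t sstar ≤ t (sstar + 1) := ht_mono sstar (by lia) (by lia)
  have hsucc : t' (sstar + 1) = t (sstar + 1) := hother _ (by lia)
  refine ⟨⟨ht'_mono, ht'_top⟩, ?_, ⟨?_, ?_, ?_⟩, ?_, ?_⟩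
  · intro q s hq
    have hiff : thresholdPolicy t' q s = thresholdPolicy t q s := by
      unfold thresholdPolicy
      congr 1
      rw [ht' s, ht' (s - 1)]
      grind
    rw [hF'', hiff]
    ring
  · simp [hF'', thresholdPolicy, hself, hsgap]
  · simp [hF'', thresholdPolicy, hself, hsucc, hnext]
  · intro s h0 hS hs hs'
    have hout : s < sstar ∧ t s < t sstar ∨ sstar + 1 < s ∧ t sstar ≤ t (s - 1) := by
      rcases lt_or_gt_of_ne hs with h | h
      · exact .inl ⟨h, (mono s (sstar - 1) (by lia) (by lia) (by lia)).trans_lt hsgap⟩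
      · exact .inr ⟨by lia, mono sstar (s - 1) (by lia) (by lia) (by lia)⟩
    have hzero : ¬(t (s - 1) < t sstar ∧ t sstar ≤ t s) := by lia
    simp only [hF'', thresholdPolicy, hother s hs, hother (s - 1) (by lia), if_neg hzero]
    ring
  · intro q h0 hQ
    have ht'_neg : t' (-1) = -1 := by rw [hother _ (by lia), ht_neg]
    simp only [hF'', Finset.sum_add_distrib, ← Finset.mul_sum]
    rw [sum_Icc_thresholdPolicy ht_mono (by lia) (by lia) le_rfl,
      sum_Icc_thresholdPolicy ht'_mono (by lia) (by lia) le_rfl,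
      if_pos (by lia), if_pos (by lia)]
    ring
  · intro q s _ _ _ _ hpos
    by_contra hnot
    have h1 : ¬(t (s - 1) < q ∧ q ≤ t s) := by lia
    have h2 : ¬(t' (s - 1) < q ∧ q ≤ t' s) := by
      rw [ht' s, ht' (s - 1)]
      grind
    simp [hF'', thresholdPolicy, h1, h2] at hpos
end
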